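/- Let $r^* \le r$ be natural numbers. Let $v_1,\ldots,v_s \in \mathbb{C}^r$ be vectors whose projections onto the first $r^*$ coordinates are linearly independent in $\mathbb{C}^{r^*}$, and let $z_1,\ldots,z_t \in \mathbb{C}^r$ be vectors whose first $r^*$ coordinates all vanish. Fix $m \in \{1,\ldots,s\}$ and for $x \ge 0$ define the Hermitian matrix $A(x) = v_m v_m^{\sf H} - x\Big(\sum_{n \neq m} v_n v_n^{\sf H} + \sum_{j=1}^t z_j z_j^{\sf H}\Big)$. Then for every $x \ge 0$, $A(x)$ has at least one strictly positive eigenvalue. -/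

import Mathlib

open Matrix Finset
open scoped ComplexOrder

/-- Structural form of the first eigenvalue lemma: if the projections of
`v 1, …, v s` onto the first `r*` coordinates are linearly independent and the
`z j` vanish on the first `r*` coordinates, then for every `m` and every `x ≥ 0`,
the Hermitian matrix
`A(x) = vₘ vₘᴴ - x (∑_{n ≠ m} vₙ vₙᴴ + ∑ⱼ zⱼ zⱼᴴ)` has a strictly positive
eigenvalue. -/
theorem stmt_16 (r rs s t : ℕ) (hrs : rs ≤ r)
    (v : Fin s → (Fin r → ℂ)) (z : Fin t → (Fin r → ℂ))
    (hv : LinearIndependent ℂ (fun n : Fin s => fun i : Fin rs => v n (Fin.castLE hrs i)))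
    (hz : ∀ j : Fin t, ∀ i : Fin r, (i : ℕ) < rs → z j i = 0)
    (m : Fin s) (x : ℝ) (hx : 0 ≤ x) :
    ∃ μ : ℝ, 0 < μ ∧ ∃ w : Fin r → ℂ, w ≠ 0 ∧
      (Matrix.vecMulVec (v m) (star (v m)) -
        (x : ℂ) • ((∑ n ∈ Finset.univ.erase m, Matrix.vecMulVec (v n) (star (v n))) +
          ∑ j, Matrix.vecMulVec (z j) (star (z j)))).mulVec w = (μ : ℂ) • w := by
  classical
  -- a dual functional of the projected family
  obtain ⟨f, hf⟩ : ∃ f : (Fin rs → ℂ) →ₗ[ℂ] ℂ, ∀ n : Fin s,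
      f (fun i : Fin rs => v n (Fin.castLE hrs i)) = if n = m then 1 else 0 := by
    obtain ⟨g, hg⟩ := LinearMap.exists_leftInverse_of_injective
      (Fintype.linearCombination ℂ (fun n : Fin s => fun i : Fin rs => v n (Fin.castLE hrs i)))
      (LinearMap.ker_eq_bot.2 hv.fintypeLinearCombination_injective)
    refine ⟨(LinearMap.proj m).comp g, fun n => ?_⟩
    have h := LinearMap.congr_fun hg (Pi.single n 1)
    simp only [LinearMap.comp_apply, Fintype.linearCombination_apply_single, one_smul,
      LinearMap.id_apply] at h
    simp only [LinearMap.comp_apply, h, LinearMap.proj_apply, Pi.single_apply, eq_comm]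
  let u : Fin r → ℂ := fun i =>
    if h : (i : ℕ) < rs then star (f (Pi.single ⟨i, h⟩ 1)) else 0
  have key : ∀ y : Fin r → ℂ,
      star y ⬝ᵥ u = star (f (fun i : Fin rs => y (Fin.castLE hrs i))) := by
    intro y
    rw [LinearMap.pi_apply_eq_sum_univ f, star_sum]
    simp only [dotProduct]
    symm
    refine Finset.sum_of_injOn (Fin.castLE hrs) (Fin.castLE_injective hrs).injOn (by simp) ?_ ?_
    · intro i _ hi
      have : ¬ (i : ℕ) < rs := fun h => hi ⟨⟨i, h⟩, by simp, by ext; simp⟩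
      simp [u, this]
    · intro i _
      have e : (fun j => if i = j then (1 : ℂ) else 0) = Pi.single i 1 := by
        ext j; simp [Pi.single_apply, eq_comm]
      rw [e]
      simp [u]
  have hvu : ∀ n, star (v n) ⬝ᵥ u = if n = m then 1 else 0 := by
    intro n
    rw [key, hf]
    split_ifs <;> simp
  have hzu : ∀ j, star (z j) ⬝ᵥ u = 0 := by
    intro j
    rw [key]
    have : (fun i : Fin rs => z j (Fin.castLE hrs i)) = 0 := by
      ext i; exact hz j _ (by simp)
    simp [this]
  set A := (Matrix.vecMulVec (v m) (star (v m)) -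
        (x : ℂ) • ((∑ n ∈ Finset.univ.erase m, Matrix.vecMulVec (v n) (star (v n))) +
          ∑ j, Matrix.vecMulVec (z j) (star (z j)))) with hA
  have hAu : A.mulVec u = v m := by
    have h1 : (∑ n ∈ Finset.univ.erase m, Matrix.vecMulVec (v n) (star (v n))).mulVec u = 0 := by
      rw [Matrix.sum_mulVec]
      refine Finset.sum_eq_zero fun n hn => ?_
      rw [Matrix.vecMulVec_mulVec, hvu, if_neg (Finset.ne_of_mem_erase hn)]
      simp
    have h2 : (∑ j, Matrix.vecMulVec (z j) (star (z j))).mulVec u = 0 := by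
      rw [Matrix.sum_mulVec]
      refine Finset.sum_eq_zero fun n hn => ?_
      rw [Matrix.vecMulVec_mulVec, hzu]
      simp
    rw [hA, Matrix.sub_mulVec, Matrix.smul_mulVec, Matrix.add_mulVec, h1, h2,
      Matrix.vecMulVec_mulVec, hvu]
    simp
  have hH : (-A).IsHermitian := by
    have hh : ∀ y : Fin r → ℂ, (Matrix.vecMulVec y (star y))ᴴ = Matrix.vecMulVec y (star y) := by
      intro y; rw [Matrix.conjTranspose_vecMulVec, star_star]
    unfold Matrix.IsHermitian
    rw [hA]
    simp [Matrix.conjTranspose_sum, Matrix.conjTranspose_smul, hh]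
  have hneg : ¬ (-A).PosSemidef := by
    intro hp
    have h := hp.re_dotProduct_nonneg u
    have h3 : star u ⬝ᵥ v m = 1 := by
      have h4 := congrArg star (hvu m)
      rw [if_pos rfl, star_one, Matrix.star_dotProduct, star_star] at h4
      rw [← h4]
    rw [Matrix.neg_mulVec, hAu, dotProduct_neg, h3] at h
    norm_num at h
  rw [hH.posSemidef_iff_eigenvalues_nonneg, Pi.le_def] at hneg
  push Not at hneg
  obtain ⟨i, hi⟩ := hneg
  refine ⟨-hH.eigenvalues i, by simpa using hi, (hH.eigenvectorBasis i).ofLp, ?_, ?_⟩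
  · intro h0
    exact hH.eigenvectorBasis.orthonormal.ne_zero i (by ext k; exact congrFun h0 k)
  · have h := hH.mulVec_eigenvectorBasis i
    rw [Matrix.neg_mulVec, neg_eq_iff_eq_neg] at h
    rw [h]
    ext k
    simp
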